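/- Let m₊ ∈ ℤ ± 1/4 with m₊ > 1, and put P3 := ∏_{u ∈ r_e(m₊ − 1)} (1 − q^{A₊} u^{−1})(1 − q^{A₊} u) / ((1 − q^{A₊+1} u^{−1})(1 − q^{A₊+1} u)) and, with N = A₊ + 1 − δ₊, P4d := ∏_{1 ≤ i < j ≤ N} (1 − q^{i+j+2δ₊−2})² / [ ∏_{1 ≤ i < j ≤ N} (1 − q^{i+j+2δ₊−1}) · ∏_{1 ≤ i < j ≤ N, i+j+2δ₊−3 ≠ 0} (1 − q^{i+j+2δ₊−3}) ]. Then the following exact identity holds in ℚ(q), regardless of whether ε₊ = δ₊ or not: P3 · P4d = (1 − q^{A₊ + 1}) / ( (1 − q)^{δ₊} · ∏_{k=1}^{A₊} (1 + q^{k}) ). -/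

import Mathlib

/-!
STATEMENT 12. `P3 · P4d = (1-q^{A₊+1}) / ((1-q)^{δ₊} ∏_{k=1}^{A₊}(1+q^k))` in `ℚ(q)`,
regardless of whether `ε₊ = δ₊` or not.  Here `m₊ = κ₊ + (2ε₊-1)/4 > 1`, `δ₊ = κ₊ mod 2`,
`A₊ = 2(κ₊-1)+ε₊`, `N = A₊ + 1 - δ₊`, `P3` is the product over the coordinates
`u ∈ r_e(m₊-1)`, and `P4d` the regularized type-D (nonzero coordinate sum) factor.
-/

noncomputable section

/-- The field `ℚ(q)`. -/
abbrev RF12 : Type := RatFunc ℚ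

/-- The indeterminate `q`. -/
def qR : RF12 := RatFunc.X

/-- Exponents of the coordinates of `σ_e(m)` for `m = κ + (2ε-1)/4`. -/
def sigmaExp (ε κ : ℕ) : Multiset ℤ := (Finset.Icc ((κ : ℤ) % 2) (2 * (κ : ℤ) - 2 + ε)).val

/-- Exponents of the coordinates of `r_e(m)` for `m = κ + (2ε-1)/4`. -/
def reExp (ε : ℕ) : ℕ → Multiset ℤ
  | 0 => 0
  | κ + 1 => sigmaExp ε (κ + 1) + reExp ε κ

/-- The pairs `1 ≤ i < j ≤ N`. -/
def pairsUpTo (N : ℕ) : Finset (ℕ × ℕ) :=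
  (Finset.Icc 1 N ×ˢ Finset.Icc 1 N).filter fun p => p.1 < p.2

/-- The factor `(P3)`. -/
def P3Expr (εp κp : ℕ) (A : ℤ) : RF12 :=
  ((reExp εp (κp - 1)).map fun e =>
      (1 - qR ^ A * (qR ^ e)⁻¹) * (1 - qR ^ A * qR ^ e) /
        ((1 - qR ^ (A + 1) * (qR ^ e)⁻¹) * (1 - qR ^ (A + 1) * qR ^ e))).prod

/-- The factor `(P4d)`, with `N = A + 1 - δ`. -/
def P4dExpr (δ A : ℕ) : RF12 :=
  (∏ p ∈ pairsUpTo (A + 1 - δ), (1 - qR ^ (p.1 + p.2 + 2 * δ - 2)) ^ 2) /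
    ((∏ p ∈ pairsUpTo (A + 1 - δ), (1 - qR ^ (p.1 + p.2 + 2 * δ - 1))) *
      ∏ p ∈ (pairsUpTo (A + 1 - δ)).filter (fun p => p.1 + p.2 + 2 * δ - 3 ≠ 0),
        (1 - qR ^ (p.1 + p.2 + 2 * δ - 3)))

lemma one_sub_qR_zpow_ne_zero {n : ℤ} (hn : n ≠ 0) : 1 - qR ^ n ≠ 0 := by
  have key : ∀ k : ℕ, k ≠ 0 → (qR : RF12) ^ k ≠ 1 := by
    intro k hk h
    have h2 : algebraMap (Polynomial ℚ) RF12 (Polynomial.X ^ k) =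
        algebraMap (Polynomial ℚ) RF12 1 := by
      rw [map_pow, RatFunc.algebraMap_X, map_one]
      exact h
    have h3 := congrArg Polynomial.natDegree (RatFunc.algebraMap_injective ℚ h2)
    simp only [Polynomial.natDegree_X_pow, Polynomial.natDegree_one] at h3
    exact hk h3
  intro h
  have h1 : qR ^ n = 1 := (sub_eq_zero.mp h).symm
  rcases Int.natAbs_eq n with h2 | h2
  · rw [h2, zpow_natCast] at h1
    exact key _ (by omega) h1
  · rw [h2, zpow_neg, zpow_natCast, inv_eq_one] at h1
    exact key _ (by omega) h1

lemma one_sub_qR_pow_ne_zero {n : ℕ} (hn : n ≠ 0) : 1 - qR ^ n ≠ 0 := by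
  have := one_sub_qR_zpow_ne_zero (n := (n : ℤ)) (by exact_mod_cast hn)
  rwa [zpow_natCast] at this

lemma qR_ne_zero : qR ≠ 0 := RatFunc.X_ne_zero

/-- `1 - q ^ n`, regularized to `1` at `n = 0`. -/
def regFactor (n : ℕ) : RF12 := if n = 0 then 1 else 1 - qR ^ n

lemma regFactor_ne_zero (n : ℕ) : regFactor n ≠ 0 := by
  unfold regFactor
  split_ifs with h
  · exact one_ne_zero
  · exact one_sub_qR_pow_ne_zero h

lemma regFactor_of_ne_zero {n : ℕ} (hn : n ≠ 0) : regFactor n = 1 - qR ^ n := if_neg hn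

lemma regFactor_zero : regFactor 0 = 1 := if_pos rfl

lemma prod_pairsUpTo {M : Type*} [CommMonoid M] (F : ℕ × ℕ → M) (N : ℕ) :
    ∏ p ∈ pairsUpTo N, F p = ∏ j ∈ Finset.range N, ∏ i ∈ Finset.range j, F (i + 1, j + 1) := by
  rw [Finset.prod_sigma']
  refine Finset.prod_bij' (fun p _ => ⟨p.2 - 1, p.1 - 1⟩) (fun x _ => (x.2 + 1, x.1 + 1))
    ?_ ?_ ?_ ?_ ?_
  · rintro ⟨a, b⟩ h
    simp only [pairsUpTo, Finset.mem_filter, Finset.mem_product, Finset.mem_Icc,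
      Finset.mem_sigma, Finset.mem_range] at h ⊢
    omega
  · rintro ⟨a, b⟩ h
    simp only [pairsUpTo, Finset.mem_filter, Finset.mem_product, Finset.mem_Icc,
      Finset.mem_sigma, Finset.mem_range] at h ⊢
    omega
  · rintro ⟨a, b⟩ h
    simp only [pairsUpTo, Finset.mem_filter, Finset.mem_product, Finset.mem_Icc] at h
    simp only [Prod.mk.injEq]
    omega
  · rintro ⟨a, b⟩ h
    simp
  · rintro ⟨a, b⟩ h
    simp only [pairsUpTo, Finset.mem_filter, Finset.mem_product, Finset.mem_Icc] at h
    dsimp only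
    rw [Nat.sub_add_cancel (by omega), Nat.sub_add_cancel (by omega)]

/-- The part of `P4dExpr` with second index `j + 1` telescopes. -/
lemma prod_range_regFactor_telescope (k n : ℕ) :
    ∏ i ∈ Finset.range n,
        regFactor (i + k) ^ 2 / (regFactor (i + k + 1) * regFactor (i + k - 1)) =
      regFactor k * regFactor (n + k - 1) / (regFactor (n + k) * regFactor (k - 1)) := by
  induction n with
  | zero =>
    have h1 := regFactor_ne_zero k
    have h2 := regFactor_ne_zero (k - 1)
    simp only [Finset.range_zero, Finset.prod_empty, zero_add]
    field_simp
  | succ n ih =>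
    rw [Finset.prod_range_succ, ih]
    have h1 := regFactor_ne_zero (n + k)
    have h2 := regFactor_ne_zero (k - 1)
    have h3 := regFactor_ne_zero (n + k - 1)
    have h4 := regFactor_ne_zero (n + k + 1)
    rw [show n + 1 + k - 1 = n + k by omega, show n + 1 + k = n + k + 1 by omega]
    field_simp

lemma prod_prod_regFactor (c N : ℕ) :
    ∏ j ∈ Finset.range N, ∏ i ∈ Finset.range j, regFactor (i + (j + c)) ^ 2 /
        (regFactor (i + (j + c) + 1) * regFactor (i + (j + c) - 1)) =
      regFactor (N + c - 1) / regFactor (c - 1) *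
        ∏ j ∈ Finset.range N, regFactor (2 * j + c - 1) / regFactor (2 * j + c) := by
  simp only [prod_range_regFactor_telescope]
  induction N with
  | zero => simp [regFactor_ne_zero]
  | succ n ih =>
    rw [Finset.prod_range_succ, ih, Finset.prod_range_succ]
    have h1 := regFactor_ne_zero (n + c)
    have h2 := regFactor_ne_zero (c - 1)
    have h3 := regFactor_ne_zero (n + c - 1)
    have h4 := regFactor_ne_zero (2 * n + c)
    rw [show n + 1 + c - 1 = n + c by omega, show n + (n + c) = 2 * n + c by omega]
    field_simp

lemma P4dExpr_eq (δ A : ℕ) :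
    P4dExpr δ A = regFactor (A + 1 - δ + 2 * δ - 1) / regFactor (2 * δ - 1) *
      ∏ j ∈ Finset.range (A + 1 - δ),
        regFactor (2 * j + 2 * δ - 1) / regFactor (2 * j + 2 * δ) := by
  rw [← prod_prod_regFactor, P4dExpr, Finset.prod_filter, ← Finset.prod_mul_distrib,
    ← Finset.prod_div_distrib, prod_pairsUpTo]
  refine Finset.prod_congr rfl fun j _ => Finset.prod_congr rfl fun i hi => ?_
  have hij := Finset.mem_range.mp hi
  dsimp only
  rw [show i + 1 + (j + 1) + 2 * δ - 2 = i + (j + 2 * δ) by omega,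
    show i + 1 + (j + 1) + 2 * δ - 1 = i + (j + 2 * δ) + 1 by omega,
    show i + 1 + (j + 1) + 2 * δ - 3 = i + (j + 2 * δ) - 1 by omega,
    regFactor_of_ne_zero (n := i + (j + 2 * δ)) (by omega),
    regFactor_of_ne_zero (n := i + (j + 2 * δ) + 1) (by omega), regFactor]
  simp only [ne_eq, ite_not]

lemma prod_Icc_telescope (A a : ℤ) (n : ℕ) (h1 : a + n ≤ A) (h2 : 0 < A + a) :
    ∏ e ∈ Finset.Icc a (a + n - 1),
        (1 - qR ^ A * (qR ^ e)⁻¹) * (1 - qR ^ A * qR ^ e) /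
          ((1 - qR ^ (A + 1) * (qR ^ e)⁻¹) * (1 - qR ^ (A + 1) * qR ^ e)) =
      (1 - qR ^ (A + 1 - a - n)) * (1 - qR ^ (A + a)) /
        ((1 - qR ^ (A + 1 - a)) * (1 - qR ^ (A + a + n))) := by
  induction n with
  | zero =>
    have h3 := one_sub_qR_zpow_ne_zero (n := A + 1 - a) (by push_cast at h1; omega)
    have h4 := one_sub_qR_zpow_ne_zero (n := A + a) (by omega)
    simp only [Nat.cast_zero, add_zero, sub_zero]
    rw [Finset.Icc_eq_empty (by omega), Finset.prod_empty, div_self (mul_ne_zero h3 h4)]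
  | succ n ih =>
    push_cast at h1 ⊢
    have hI : Finset.Icc a (a + (n + 1) - 1) = insert (a + n) (Finset.Icc a (a + n - 1)) := by
      ext x
      simp only [Finset.mem_Icc, Finset.mem_insert]
      omega
    rw [hI, Finset.prod_insert (by simp), ih (by omega)]
    have h3 := one_sub_qR_zpow_ne_zero (n := A + 1 - a) (by omega)
    have h4 := one_sub_qR_zpow_ne_zero (n := A + a + n) (by omega)
    have h5 := one_sub_qR_zpow_ne_zero (n := A + a + n + 1) (by omega)
    have h6 := one_sub_qR_zpow_ne_zero (n := A + 1 - a - n) (by omega)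
    simp only [← zpow_neg, ← zpow_add₀ qR_ne_zero]
    rw [show A + -(a + n) = A + 1 - a - (n + 1) by ring, show A + (a + n) = A + a + n by ring,
      show A + 1 + -(a + n) = A + 1 - a - n by ring,
      show A + 1 + (a + n) = A + a + n + 1 by ring,
      show A + a + (n + 1) = A + a + n + 1 by ring]
    field_simp

lemma P3Expr_eq (ε K : ℕ) (A : ℕ) (hA0 : 0 < A) (hA : 2 * K + ε ≤ A + 1) :
    P3Expr ε (K + 1) A = (∏ k ∈ Finset.range K,
        regFactor (A - 2 * k - ε) / regFactor (A + 1 + 2 * k + ε)) *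
      (if K % 2 = 1 then regFactor (A + 1) / regFactor A else 1) := by
  have hφ : ∀ (z : ℤ) (n : ℕ), n ≠ 0 → z = n → 1 - qR ^ z = regFactor n := by
    intro z n hn hz
    rw [regFactor_of_ne_zero hn, hz, zpow_natCast]
  rw [P3Expr, Nat.add_sub_cancel]
  induction K with
  | zero => simp [reExp]
  | succ K ih =>
    have hA' := ih (by omega)
    rw [reExp, Multiset.map_add, Multiset.prod_add, hA', Finset.prod_range_succ, sigmaExp,
      ← Finset.prod_eq_multiset_prod]
    have g1 := regFactor_ne_zero A
    have g2 := regFactor_ne_zero (A + 1)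
    have g3 := regFactor_ne_zero (A + 1 + 2 * K + ε)
    rcases Nat.mod_two_eq_zero_or_one K with hK | hK
    · have e1 : ((K + 1 : ℕ) : ℤ) % 2 = 1 := by omega
      have e2 : 2 * ((K + 1 : ℕ) : ℤ) - 2 + ε = 1 + ((2 * K + ε : ℕ) : ℤ) - 1 := by
        push_cast; ring
      rw [e1, e2, prod_Icc_telescope _ _ _ (by omega) (by omega),
        hφ _ (A - 2 * K - ε) (by omega) (by omega), hφ _ (A + 1) (by omega) (by omega),
        hφ _ A (by omega) (by omega),
        hφ _ (A + 1 + 2 * K + ε) (by omega) (by omega), if_neg (by omega), if_pos (by omega)]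
      field_simp
    · have e1 : ((K + 1 : ℕ) : ℤ) % 2 = 0 := by omega
      have e2 : 2 * ((K + 1 : ℕ) : ℤ) - 2 + ε = 0 + ((2 * K + ε + 1 : ℕ) : ℤ) - 1 := by
        push_cast; ring
      rw [e1, e2, prod_Icc_telescope _ _ _ (by omega) (by omega),
        hφ _ (A - 2 * K - ε) (by omega) (by omega), hφ _ A (by omega) (by omega),
        hφ _ (A + 1) (by omega) (by omega),
        hφ _ (A + 1 + 2 * K + ε) (by omega) (by omega), if_pos hK, if_neg (by omega)]
      field_simp

lemma prod_range_odd_even {M : Type*} [CommMonoid M] (G : ℕ → M) (ε : ℕ)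
    (hε : ε = 0 ∨ ε = 1) (K : ℕ) :
    ∏ j ∈ Finset.range (2 * K + ε), G (j + 1) =
      (∏ j ∈ Finset.range (K + ε), G (2 * j + 1)) * ∏ k ∈ Finset.range K, G (2 * k + 2) := by
  have h0 : ∀ n, ∏ j ∈ Finset.range (2 * n), G (j + 1) =
      (∏ j ∈ Finset.range n, G (2 * j + 1)) * ∏ k ∈ Finset.range n, G (2 * k + 2) := by
    intro n
    induction n with
    | zero => simp
    | succ n ih =>
      rw [show 2 * (n + 1) = 2 * n + 1 + 1 by ring, Finset.prod_range_succ,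
        Finset.prod_range_succ, ih, Finset.prod_range_succ _ n, Finset.prod_range_succ _ n,
        mul_assoc, mul_mul_mul_comm]
  rcases hε with rfl | rfl
  · simpa using h0 K
  · rw [Finset.prod_range_succ, h0, Finset.prod_range_succ _ K, mul_right_comm]

lemma prod_regFactor_mul_prod (ε K : ℕ) (hε : ε = 0 ∨ ε = 1) :
    (∏ k ∈ Finset.range K,
        regFactor (2 * K + ε - 2 * k - ε) / regFactor (2 * K + ε + 1 + 2 * k + ε)) *
      ∏ j ∈ Finset.range (2 * K + ε), regFactor (2 * j + 1) / regFactor (2 * j + 2) =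
      (∏ k ∈ Finset.Icc 1 (2 * K + ε), (1 + qR ^ k))⁻¹ := by
  have hrefl : ∏ k ∈ Finset.range K, regFactor (2 * K + ε - 2 * k - ε) =
      ∏ k ∈ Finset.range K, regFactor (2 * k + 2) := by
    rw [← Finset.prod_range_reflect]
    refine Finset.prod_congr rfl fun k hk => ?_
    have := Finset.mem_range.mp hk
    congr 1
    omega
  have hodd : ∏ j ∈ Finset.range (2 * K + ε), regFactor (2 * j + 1) =
      (∏ j ∈ Finset.range (K + ε), regFactor (2 * j + 1)) *
        ∏ k ∈ Finset.range K, regFactor (2 * K + ε + 1 + 2 * k + ε) := by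
    rw [show 2 * K + ε = K + ε + K by ring, Finset.prod_range_add]
    congr 1
    refine Finset.prod_congr rfl fun k _ => ?_
    congr 1
    ring
  have hplus : (∏ k ∈ Finset.Icc 1 (2 * K + ε), (1 + qR ^ k)) *
      ∏ j ∈ Finset.range (2 * K + ε), regFactor (j + 1) =
      ∏ j ∈ Finset.range (2 * K + ε), regFactor (2 * j + 2) := by
    rw [Finset.range_eq_Ico, Finset.prod_Ico_add' (fun k => regFactor k) 0 (2 * K + ε) 1,
      ← Finset.range_eq_Ico, zero_add, Finset.Ico_add_one_right_eq_Icc,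
      ← Finset.prod_mul_distrib, Finset.range_eq_Ico]
    have h := Finset.prod_Ico_add' (fun k => regFactor (2 * k)) 0 (2 * K + ε) 1
    rw [zero_add, Finset.Ico_add_one_right_eq_Icc] at h
    refine Eq.trans ?_ h.symm
    refine Finset.prod_congr rfl fun k hk => ?_
    have := Finset.mem_Icc.mp hk
    rw [regFactor_of_ne_zero (n := k) (by omega), regFactor_of_ne_zero (n := 2 * k) (by omega)]
    ring
  have hne : ∏ j ∈ Finset.range (2 * K + ε), regFactor (2 * j + 2) ≠ 0 :=
    Finset.prod_ne_zero_iff.mpr fun _ _ => regFactor_ne_zero _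
  have hne' : ∏ k ∈ Finset.range K, regFactor (2 * K + ε + 1 + 2 * k + ε) ≠ 0 :=
    Finset.prod_ne_zero_iff.mpr fun _ _ => regFactor_ne_zero _
  rw [Finset.prod_div_distrib, Finset.prod_div_distrib, hrefl, hodd]
  rw [← hplus] at hne ⊢
  have hp := left_ne_zero_of_mul hne
  have hq := right_ne_zero_of_mul hne
  rw [prod_range_odd_even regFactor ε hε K] at hq ⊢
  have hq1 := left_ne_zero_of_mul hq
  have hq2 := right_ne_zero_of_mul hq
  field_simp

theorem statement12 (κp εp δp : ℕ) (hεp : εp = 0 ∨ εp = 1) (hδp : δp = κp % 2)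
    (mplus : ℚ) (hmp : mplus = κp + (2 * (εp : ℚ) - 1) / 4) (h1 : 1 < mplus)
    (A : ℕ) (hA : (A : ℤ) = 2 * (κp : ℤ) - 2 + εp) :
    P3Expr εp κp A * P4dExpr δp A =
      (1 - qR ^ (A + 1)) / ((1 - qR) ^ δp * ∏ k ∈ Finset.Icc 1 A, (1 + qR ^ k)) := by
  obtain ⟨K, rfl⟩ : ∃ K, κp = K + 1 := by
    refine Nat.exists_eq_succ_of_ne_zero ?_
    rintro rfl
    omega
  have hA' : A = 2 * K + εp := by
    push_cast at hA
    omega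
  have hApos : 0 < A := by
    rcases Nat.eq_zero_or_pos A with h0 | h0
    · have hK : K = 0 := by omega
      have hε : εp = 0 := by omega
      subst hK hε
      norm_num [hmp] at h1
    · exact h0
  have hmain := prod_regFactor_mul_prod εp K hεp
  rw [← hA'] at hmain
  rw [P3Expr_eq εp K A hApos (by omega), P4dExpr_eq, div_mul_eq_div_div,
    div_eq_mul_inv _ (∏ k ∈ _, _), ← hmain, ← regFactor_of_ne_zero (n := A + 1) (by omega)]
  have g1 := regFactor_ne_zero A
  have g2 := regFactor_ne_zero (A + 1)
  rcases Nat.mod_two_eq_zero_or_one K with hK | hK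
  · obtain rfl : δp = 1 := by omega
    have hq : regFactor 1 = 1 - qR := by simp [regFactor]
    rw [if_neg (by omega), Nat.add_sub_cancel, show A + 2 * 1 - 1 = A + 1 by omega,
      show 2 * 1 - 1 = 1 by norm_num, hq, pow_one]
    simp only [mul_one, show ∀ j, 2 * j + 2 - 1 = 2 * j + 1 by intro j; omega]
    ring
  · obtain rfl : δp = 0 := by omega
    rw [if_pos hK, Nat.sub_zero, Finset.prod_range_succ']
    simp only [mul_zero, add_zero, Nat.add_sub_cancel, Nat.zero_sub, regFactor_zero, pow_zero,
      div_one, mul_one, mul_add, show ∀ j, 2 * j + 2 - 1 = 2 * j + 1 by intro j; omega]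
    field_simp
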